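/- Let p > 3 be a prime, q = p^t a power of p, and n = p u where gcd(p, u) = 1 and u > 2. Then there exists an element of F_{q^n} that is simultaneously 2-primitive and 1-normal over F_q. -/

import Mathlib

/-- The `F_q`-span of the conjugates `α, α^q, …, α^{q^{n-1}}` of `α ∈ F_{q^n}`. -/
def conjSpan (K : Type*) {L : Type*} [Field K] [Field L] [Algebra K L]
    (q n : ℕ) (α : L) : Submodule K L :=
  Submodule.span K (Set.range fun i : Fin n => α ^ q ^ (i : ℕ))

open Finset

section CharacterSums

variable {F : Type*} [Field F] [Fintype F]

theorem MulChar.norm_apply_of_ne_zero (χ : MulChar F ℂ) {x : F} (hx : x ≠ 0) : ‖χ x‖ = 1 := by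
  have h : χ x ^ (Fintype.card F - 1) = 1 := by
    rw [← map_pow, FiniteField.pow_card_sub_one_eq_one x hx, map_one]
  exact Complex.norm_eq_one_of_pow_eq_one h
    (Nat.sub_pos_of_lt Fintype.one_lt_card).ne'

theorem MulChar.sum_add_mul_star {χ : MulChar F ℂ} (hχ : χ ≠ 1) {v : F} (hv : v ≠ 0) :
    ∑ x, χ (x + v) * star (χ x) = -1 := by
  classical
  have key : ∀ x, χ (x + v) * star (χ x) = χ (1 + v * x⁻¹) - if x = 0 then 1 else 0 := by
    intro x
    rw [MulChar.star_apply', MulChar.inv_apply']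
    by_cases hx : x = 0
    · simp [hx]
    · rw [if_neg hx, sub_zero, ← map_mul, add_mul, mul_inv_cancel₀ hx]
  have hb : ∑ x, χ (1 + v * x⁻¹) = ∑ y, χ y :=
    Fintype.sum_bijective (fun x : F => 1 + v * x⁻¹)
      ((AddGroup.addLeft_bijective (1 : F)).comp
        ((mulLeft_bijective₀ v hv).comp inv_involutive.bijective)) _ _ fun _ => rfl
  simp_rw [key, sum_sub_distrib, hb, MulChar.sum_eq_zero_of_ne_one hχ]
  simp

theorem MulChar.sum_norm_sq_translate_le {χ : MulChar F ℂ} (hχ : χ ≠ 1) (V : Finset F) :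
    ∑ x, ‖∑ v ∈ V, χ (x + v)‖ ^ 2 ≤ (#V * Fintype.card F : ℝ) := by
  classical
  have hpair : ∀ v w : F, ∑ x, χ (x + v) * star (χ (x + w)) =
      if v = w then ((Fintype.card F - 1 : ℝ) : ℂ) else -1 := by
    intro v w
    have hshift : ∑ x, χ (x + v) * star (χ (x + w)) =
        ∑ x, χ (x + (v - w)) * star (χ x) := by
      refine Fintype.sum_equiv (Equiv.addRight w) _ _ fun x => ?_
      simp only [Equiv.coe_addRight]
      rw [add_assoc, add_sub_cancel]
    rw [hshift]
    split_ifs with h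
    · subst h
      have : ∀ x, χ (x + (v - v)) * star (χ x) = 1 - if x = 0 then 1 else 0 := by
        intro x
        by_cases hx : x = 0
        · simp [hx]
        · rw [sub_self, add_zero, if_neg hx, sub_zero, RCLike.star_def, Complex.mul_conj,
            Complex.normSq_eq_norm_sq, χ.norm_apply_of_ne_zero hx]
          simp
      simp_rw [this, sum_sub_distrib]
      simp
    · exact χ.sum_add_mul_star hχ (sub_ne_zero.mpr h)
  have hexp : ((∑ x, ‖∑ v ∈ V, χ (x + v)‖ ^ 2 : ℝ) : ℂ) =
      ((∑ v ∈ V, ∑ w ∈ V, if v = w then (Fintype.card F - 1 : ℝ) else -1 : ℝ) : ℂ) := by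
    push_cast
    calc _ = ∑ x, ∑ v ∈ V, ∑ w ∈ V, χ (x + v) * star (χ (x + w)) := by
          refine sum_congr rfl fun x _ => ?_
          rw [← sum_mul_sum, ← star_sum, RCLike.star_def, Complex.mul_conj,
            Complex.normSq_eq_norm_sq]
          push_cast
          rfl
      _ = ∑ v ∈ V, ∑ w ∈ V, ∑ x, χ (x + v) * star (χ (x + w)) := by
          rw [sum_comm]
          exact sum_congr rfl fun v _ => sum_comm
      _ = _ := by
          simp_rw [hpair]
          refine sum_congr rfl fun v _ => sum_congr rfl fun w _ => ?_
          split_ifs <;> simp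
  rw [Complex.ofReal_inj.mp hexp]
  calc _ ≤ ∑ v ∈ V, ∑ w ∈ V, if v = w then (Fintype.card F : ℝ) else 0 := by
        refine sum_le_sum fun v _ => sum_le_sum fun w _ => ?_
        split_ifs <;> linarith
    _ = _ := by simp

/-- The multiplicative character sum over a union of additive cosets. -/
theorem MulChar.norm_sum_cosets_sq_le {χ : MulChar F ℂ} (hχ : χ ≠ 1) {ι : Type*} [Fintype ι]
    (b : ι → F) (V : AddSubgroup F) [Fintype V]
    (hb : ∀ i j, b i - b j ∈ V → i = j) :
    ‖∑ i, ∑ v : V, χ (b i + v)‖ ^ 2 ≤ (Fintype.card ι * Fintype.card F : ℝ) := by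
  classical
  set S : F → ℂ := fun x => ∑ v : V, χ (x + v) with hS
  have hinv : ∀ (x : F) (w : V), S (x + w) = S x := by
    intro x w
    simp only [hS]
    refine Fintype.sum_equiv (Equiv.addLeft w) _ _ fun v => ?_
    simp [add_assoc]
  have htot : ∑ x, ‖S x‖ ^ 2 ≤ (Fintype.card V * Fintype.card F : ℝ) := by
    have h := MulChar.sum_norm_sq_translate_le hχ ((univ : Finset V).map ⟨Subtype.val,
      Subtype.val_injective⟩)
    simpa [hS] using h
  have hinj : Function.Injective fun z : ι × V => b z.1 + z.2 := by
    rintro ⟨i, v⟩ ⟨j, w⟩ h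
    simp only at h
    have hij : i = j := hb i j (by
      have : b i - b j = w - v := by linear_combination h
      rw [this]
      exact V.sub_mem w.2 v.2)
    subst hij
    simpa using h
  have hpart : (Fintype.card V : ℝ) * ∑ i, ‖S (b i)‖ ^ 2 ≤ ∑ x, ‖S x‖ ^ 2 := by
    calc _ = ∑ z : ι × V, ‖S (b z.1 + z.2)‖ ^ 2 := by
          rw [Fintype.sum_prod_type, mul_sum]
          simp [hinv]
      _ = ∑ x ∈ univ.map ⟨_, hinj⟩, ‖S x‖ ^ 2 := by rw [sum_map]; rfl
      _ ≤ _ := sum_le_univ_sum_of_nonneg fun x => by positivity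
  have hV : (0 : ℝ) < Fintype.card V := by exact_mod_cast Fintype.card_pos
  have hsum : ∑ i, ‖S (b i)‖ ^ 2 ≤ (Fintype.card F : ℝ) :=
    le_of_mul_le_mul_left (hpart.trans htot) hV
  calc ‖∑ i, S (b i)‖ ^ 2 ≤ (∑ i, ‖S (b i)‖) ^ 2 := by
        gcongr
        exact norm_sum_le _ _
    _ ≤ Fintype.card ι * ∑ i, ‖S (b i)‖ ^ 2 := by
        simpa using sq_sum_le_card_mul_sum_sq (s := (univ : Finset ι)) (f := fun i => ‖S (b i)‖)
    _ ≤ _ := by gcongr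

end CharacterSums

section PrimitiveSieve

variable {F : Type*} [Field F]

/-- The function `1 - ℓ⁻¹ ∑_{j < ℓ} ω ^ j`, which is the indicator function of `ω x ≠ 1` on units
when `ω` is a character of order `ℓ`. -/
noncomputable def nonKernelIndicator (ω : ℕ → MulChar F ℂ) (l : ℕ) : F → ℂ :=
  1 - (l : ℂ)⁻¹ • ∑ j ∈ range l, ⇑(ω l ^ j)

theorem sum_pow_apply_eq_of_apply_eq_one {ω : MulChar F ℂ} {x : F} (hx : x ≠ 0) (h : ω x = 1)
    (l : ℕ) : ∑ j ∈ range l, (ω ^ j) x = l := by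
  have : ∀ j, (ω ^ j) x = 1 := fun j => by
    simpa [h] using MulChar.pow_apply_coe ω j (Units.mk0 x hx)
  simp [this]

variable [Fintype F]

theorem norm_map_mul_prod_nonKernelIndicator_sub_le (Λ : (F → ℂ) →ₗ[ℂ] ℂ) {T B : ℝ} (hB : 0 ≤ B)
    (hT : Λ (1 : MulChar F ℂ) = T) (hΛ : ∀ χ : MulChar F ℂ, χ ≠ 1 → ‖Λ χ‖ ≤ B)
    (ω : ℕ → MulChar F ℂ) (s : Finset ℕ) :
    (∀ l ∈ s, l.Prime) → (∀ l ∈ s, orderOf (ω l) = l) →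
    ∀ χ : MulChar F ℂ, (∀ l ∈ s, ¬ l ∣ orderOf χ) →
      ‖Λ (χ * ∏ l ∈ s, nonKernelIndicator ω l) -
        ((∏ l ∈ s, (1 - (l : ℝ)⁻¹)) * (open Classical in if χ = 1 then T else 0) : ℝ)‖ ≤
        (∏ l ∈ s, (1 - (l : ℝ)⁻¹)) * 2 ^ #s * B := by
  classical
  induction s using Finset.induction_on with
  | empty =>
    intro _ _ χ _
    by_cases h : χ = 1
    · simp [h, hT, hB]
    · simpa [h] using hΛ χ h
  | insert l s hl ih =>
    intro hs hω χ hχ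
    have hlp : l.Prime := hs l (mem_insert_self _ _)
    have hωl : orderOf (ω l) = l := hω l (mem_insert_self _ _)
    have hlχ : ¬ l ∣ orderOf χ := hχ l (mem_insert_self _ _)
    have hl1 : (1 : ℝ) ≤ l := by exact_mod_cast hlp.one_le
    have ih' := ih (fun k hk => hs k (mem_insert_of_mem hk))
      fun k hk => hω k (mem_insert_of_mem hk)
    set θ : ℝ := ∏ k ∈ s, (1 - (k : ℝ)⁻¹)
    set P : F → ℂ := ∏ k ∈ s, nonKernelIndicator ω k
    have hord : ∀ j, ∀ k ∈ s, ¬ k ∣ orderOf (χ * ω l ^ j) := by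
      intro j k hk hdvd
      have hkp := hs k (mem_insert_of_mem hk)
      have h1 : orderOf (χ * ω l ^ j) ∣ orderOf χ * l := by
        refine (Commute.all χ (ω l ^ j)).orderOf_mul_dvd_mul_orderOf.trans
          (mul_dvd_mul_left _ ?_)
        exact (orderOf_pow_dvd j).trans hωl.dvd
      rcases hkp.dvd_mul.mp (hdvd.trans h1) with h | h
      · exact hχ k (mem_insert_of_mem hk) h
      · exact hl (((Nat.prime_dvd_prime_iff_eq hkp hlp).mp h) ▸ hk)
    have hne : ∀ j ∈ range (l - 1), χ * ω l ^ (j + 1) ≠ 1 := by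
      intro j hj h
      have hj' : j + 1 < l := by have := mem_range.mp hj; omega
      have h2 : ω l ^ ((j + 1) * orderOf χ) = 1 := by
        have h3 : ω l ^ (j + 1) = χ⁻¹ := eq_inv_of_mul_eq_one_right h
        rw [pow_mul, h3, inv_pow, pow_orderOf_eq_one, inv_one]
      rw [← orderOf_dvd_iff_pow_eq_one, hωl] at h2
      rcases hlp.dvd_mul.mp h2 with h | h
      · exact absurd (Nat.le_of_dvd (Nat.succ_pos j) h) (by omega)
      · exact hlχ h
    have hexp : Λ (χ * ∏ k ∈ insert l s, nonKernelIndicator ω k) =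
        (1 - (l : ℂ)⁻¹) * Λ (χ * P) -
          (l : ℂ)⁻¹ * ∑ j ∈ range (l - 1), Λ (⇑(χ * ω l ^ (j + 1)) * P) := by
      have : (χ : F → ℂ) * ∏ k ∈ insert l s, nonKernelIndicator ω k =
          (1 - (l : ℂ)⁻¹) • (χ * P) -
            (l : ℂ)⁻¹ • ∑ j ∈ range (l - 1), (⇑(χ * ω l ^ (j + 1)) * P) := by
        rw [prod_insert hl, nonKernelIndicator]
        obtain ⟨m, rfl⟩ : ∃ m, l = m + 1 := ⟨l - 1, by have := hlp.pos; omega⟩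
        rw [sum_range_succ', Nat.add_sub_cancel]
        have h0 : (χ : F → ℂ) * ⇑(ω (m + 1) ^ 0) = χ := by
          rw [← MulChar.coeToFun_mul, pow_zero, mul_one]
        have hS : ∑ j ∈ range m, (⇑(χ * ω (m + 1) ^ (j + 1)) * P) =
            χ * ((∑ j ∈ range m, ⇑(ω (m + 1) ^ (j + 1))) * P) := by
          rw [sum_mul, mul_sum]
          exact sum_congr rfl fun j _ => by rw [MulChar.coeToFun_mul, mul_assoc]
        rw [hS]
        have : ∀ (c : ℂ) (S : F → ℂ), (χ : F → ℂ) * ((1 - c • (S + ⇑(ω (m + 1) ^ 0))) * P) =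
            χ * P - c • (χ * (S * P)) - c • ((χ * ⇑(ω (m + 1) ^ 0)) * P) := by
          intro c S
          ext x
          simp only [Pi.mul_apply, Pi.sub_apply, Pi.smul_apply, Pi.add_apply, Pi.one_apply,
            smul_eq_mul]
          ring
        rw [this, h0]
        module
      rw [this, map_sub, map_smul, map_smul, map_sum]
      simp
    have hcast : (((l - 1 : ℕ) : ℝ)) = l - 1 := by
      rw [Nat.cast_sub hlp.one_le]; simp
    have hinv : (l : ℝ)⁻¹ ≤ 1 := inv_le_one_of_one_le₀ hl1
    have hmain := ih' χ fun k hk => hχ k (mem_insert_of_mem hk)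
    have herr : ‖∑ j ∈ range (l - 1), Λ (⇑(χ * ω l ^ (j + 1)) * P)‖ ≤
        (l - 1) * (θ * 2 ^ #s * B) := by
      refine (norm_sum_le_of_le _ fun j hj => ?_).trans_eq
        (b := ∑ j ∈ range (l - 1), θ * 2 ^ #s * B) ?_
      · simpa [hne j hj] using ih' (χ * ω l ^ (j + 1)) (hord _)
      · rw [sum_const, card_range, nsmul_eq_mul, hcast]
    have hθ : ∏ k ∈ insert l s, (1 - (k : ℝ)⁻¹) = (1 - (l : ℝ)⁻¹) * θ := prod_insert hl
    rw [hexp, hθ, card_insert_of_notMem hl]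
    set t : ℝ := if χ = 1 then T else 0
    set y := ∑ j ∈ range (l - 1), Λ (⇑(χ * ω l ^ (j + 1)) * P)
    have hl' : (l : ℝ) ≠ 0 := by positivity
    calc _ = ‖((1 - (l : ℝ)⁻¹ : ℝ) : ℂ) * (Λ (χ * P) - (θ * t : ℝ)) -
            (((l : ℝ)⁻¹ : ℝ) : ℂ) * y‖ := by
          congr 1
          push_cast
          ring
      _ ≤ (1 - (l : ℝ)⁻¹) * (θ * 2 ^ #s * B) + (l : ℝ)⁻¹ * ((l - 1) * (θ * 2 ^ #s * B)) := by
          refine (norm_sub_le _ _).trans (add_le_add ?_ ?_)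
          · rw [norm_mul, Complex.norm_of_nonneg (by linarith)]
            gcongr
          · rw [norm_mul, Complex.norm_of_nonneg (by positivity)]
            gcongr
      _ = _ := by
          field_simp
          ring

theorem map_sum_mul_prod_nonKernelIndicator_ne_zero (Λ : (F → ℂ) →ₗ[ℂ] ℂ) {T B : ℝ} (hB : 0 ≤ B)
    (hT : Λ (1 : MulChar F ℂ) = T) (hΛ : ∀ χ : MulChar F ℂ, χ ≠ 1 → ‖Λ χ‖ ≤ B)
    (ω : ℕ → MulChar F ℂ) (s : Finset ℕ) (hs : ∀ l ∈ s, l.Prime)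
    (hω : ∀ l ∈ s, orderOf (ω l) = l) (ψ : MulChar F ℂ) {d : ℕ} (hd : 0 < d)
    (hψ : orderOf ψ = d) (hds : ∀ l ∈ s, ¬ l ∣ d) (ε : ℂ) (hε : ‖ε‖ = 1)
    (hlarge : d * 2 ^ #s * B < T) :
    Λ ((∑ j ∈ range d, ε ^ j • ⇑(ψ ^ j)) * ∏ l ∈ s, nonKernelIndicator ω l) ≠ 0 := by
  classical
  have hbound := norm_map_mul_prod_nonKernelIndicator_sub_le Λ hB hT hΛ ω s hs hω
  set P : F → ℂ := ∏ l ∈ s, nonKernelIndicator ω l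
  set θ : ℝ := ∏ k ∈ s, (1 - (k : ℝ)⁻¹)
  have hθ : 0 < θ := prod_pos fun k hk => by
    have : (1 : ℝ) < k := by exact_mod_cast (hs k hk).one_lt
    linarith [inv_lt_one_of_one_lt₀ this]
  obtain ⟨m, rfl⟩ : ∃ m, d = m + 1 := ⟨d - 1, by omega⟩
  have hord : ∀ j, ∀ k ∈ s, ¬ k ∣ orderOf (ψ ^ j) := fun j k hk h =>
    hds k hk (h.trans ((orderOf_pow_dvd j).trans hψ.dvd))
  have h0 := hbound 1 (by simpa using hord 0)
  have hj : ∀ j ∈ range m, ‖ε ^ (j + 1) * Λ (⇑(ψ ^ (j + 1)) * P)‖ ≤ θ * 2 ^ #s * B := by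
    intro j hj
    have hne : ψ ^ (j + 1) ≠ 1 := fun h => by
      rw [← orderOf_dvd_iff_pow_eq_one, hψ] at h
      have := Nat.le_of_dvd (Nat.succ_pos j) h
      have := mem_range.mp hj
      omega
    simpa [hne, hε] using hbound (ψ ^ (j + 1)) (hord _)
  rw [sum_range_succ', add_mul, sum_mul, map_add, map_sum]
  simp_rw [smul_mul_assoc, map_smul, smul_eq_mul]
  rw [pow_zero, pow_zero, one_mul]
  intro h
  have hsum := norm_sum_le_of_le _ hj
  rw [eq_neg_of_add_eq_zero_left h, norm_neg, sum_const, card_range, nsmul_eq_mul] at hsum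
  simp only [if_true] at h0
  have hfin : θ * T ≤ (m + 1) * (θ * 2 ^ #s * B) := by
    calc θ * T ≤ ‖((θ * T : ℝ) : ℂ)‖ := by
          rw [Complex.norm_real]; exact le_abs_self _
      _ ≤ ‖Λ (⇑(1 : MulChar F ℂ) * P)‖ + ‖Λ (⇑(1 : MulChar F ℂ) * P) - ((θ * T : ℝ) : ℂ)‖ := by
          have := norm_sub_le (Λ (⇑(1 : MulChar F ℂ) * P))
            (Λ (⇑(1 : MulChar F ℂ) * P) - ((θ * T : ℝ) : ℂ))
          rwa [sub_sub_cancel] at this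
      _ ≤ _ := by linarith
  push_cast at hlarge
  nlinarith [mul_lt_mul_of_pos_left hlarge hθ]

theorem MulChar.apply_eq_one_iff_pow_eq_one (ω : MulChar F ℂ) {x : F} (hx : x ≠ 0) :
    ω x = 1 ↔ x ^ ((Fintype.card F - 1) / orderOf ω) = 1 := by
  classical
  obtain ⟨g, hg⟩ := IsCyclic.exists_generator (α := Fˣ)
  obtain ⟨k, hk⟩ : ∃ k : ℕ, g ^ k = Units.mk0 x hx :=
    (mem_powers_iff_mem_zpowers.mpr (hg _))
  have hk' : x = (g : F) ^ k := by
    rw [← Units.val_pow_eq_pow_val, hk, Units.val_mk0]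
  have hωg : orderOf (ω g) = orderOf ω := by
    refine Nat.dvd_antisymm ?_ ?_
    · rw [orderOf_dvd_iff_pow_eq_one, ← MulChar.pow_apply_coe, pow_orderOf_eq_one]
      exact MulChar.one_apply_coe g
    · rw [orderOf_dvd_iff_pow_eq_one, MulChar.eq_iff hg, MulChar.pow_apply_coe,
        pow_orderOf_eq_one, MulChar.one_apply_coe]
  have hgo : orderOf (g : F) = Fintype.card F - 1 := by
    rw [orderOf_units, orderOf_eq_card_of_forall_mem_zpowers hg, Nat.card_eq_fintype_card,
      Fintype.card_units]
  obtain ⟨e, he⟩ := MulChar.orderOf_dvd_card_sub_one F ω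
  have hpos : 0 < Fintype.card F - 1 := Nat.sub_pos_of_lt Fintype.one_lt_card
  have hω0 : 0 < orderOf ω := ω.orderOf_pos
  have he0 : 0 < e := Nat.pos_of_ne_zero fun h => by simp [h] at he; omega
  rw [hk', map_pow, ← orderOf_dvd_iff_pow_eq_one, hωg, ← pow_mul, ← orderOf_dvd_iff_pow_eq_one,
    hgo, he, Nat.mul_div_cancel_left _ hω0]
  exact (Nat.mul_dvd_mul_iff_right he0).symm

theorem exists_mulChar_complex_orderOf {d : ℕ} (hd : d ∣ Fintype.card F - 1) :
    ∃ χ : MulChar F ℂ, orderOf χ = d := by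
  have hd0 : d ≠ 0 := by
    rintro rfl
    have := Nat.sub_pos_of_lt (Fintype.one_lt_card (α := F))
    simp at hd
    omega
  exact MulChar.exists_mulChar_orderOf F hd (Complex.isPrimitiveRoot_exp d hd0)

/-- A union of sufficiently many additive cosets contains an element of order `(#F - 1) / 2`. -/
theorem exists_orderOf_eq_half_of_cosets (heven : Even (Fintype.card F - 1)) {ι : Type*} [Fintype ι]
    (b : ι → F) (V : AddSubgroup F) [Fintype V] (hb : ∀ i j, b i - b j ∈ V → i = j)
    (hb0 : ∀ i, ∀ v ∈ V, b i + v ≠ 0)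
    (hlarge : 4 * 4 ^ #(Fintype.card F - 1).primeFactors * Fintype.card F <
      Fintype.card ι * Fintype.card V ^ 2) :
    ∃ i, ∃ v ∈ V, orderOf (b i + v) = (Fintype.card F - 1) / 2 := by
  classical
  set m := Fintype.card F - 1 with hm
  have hm0 : 0 < m := Nat.sub_pos_of_lt Fintype.one_lt_card
  set s := m.primeFactors.erase 2 with hs
  have h2m : 2 ∈ m.primeFactors := by
    simp [Nat.prime_two, hm0.ne', heven.two_dvd]
  have hcard : #m.primeFactors = #s + 1 := (card_erase_add_one h2m).symm
  have hsp : ∀ l ∈ s, l.Prime := fun l hl => Nat.prime_of_mem_primeFactors (mem_of_mem_erase hl)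
  have hsm : ∀ l ∈ s, l ∣ m := fun l hl => Nat.dvd_of_mem_primeFactors (mem_of_mem_erase hl)
  have hs2 : ∀ l ∈ s, l ≠ 2 := fun l hl => ne_of_mem_erase hl
  have hex : ∀ l, ∃ χ : MulChar F ℂ, l ∈ s → orderOf χ = l := fun l => by
    by_cases hl : l ∈ s
    · exact (exists_mulChar_complex_orderOf (hsm l hl)).imp fun _ h _ => h
    · exact ⟨1, fun h => absurd h hl⟩
  choose ω hω using hex
  let Λ : (F → ℂ) →ₗ[ℂ] ℂ := ∑ i, ∑ v : V, LinearMap.proj (b i + v)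
  have hΛ : ∀ f, Λ f = ∑ i, ∑ v : V, f (b i + v) := fun f => by simp [Λ]
  set T : ℝ := Fintype.card ι * Fintype.card V with hT
  set B : ℝ := √(Fintype.card ι * Fintype.card F) with hB
  have hT1 : Λ (1 : MulChar F ℂ) = T := by
    rw [hΛ]
    have : ∀ i (v : V), (1 : MulChar F ℂ) (b i + v) = 1 := fun i v =>
      MulChar.one_apply (hb0 i v v.2).isUnit
    simp [this, hT]
  have hΛB : ∀ χ : MulChar F ℂ, χ ≠ 1 → ‖Λ χ‖ ≤ B := fun χ hχ => by
    rw [hΛ]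
    exact Real.le_sqrt_of_sq_le (MulChar.norm_sum_cosets_sq_le hχ b V hb)
  have hTB : 4 * 2 ^ #s * B < T := by
    have hBsq : B ^ 2 = Fintype.card ι * Fintype.card F := Real.sq_sqrt (by positivity)
    have hι : 0 < Fintype.card ι := Nat.pos_of_ne_zero fun h => by simp [h] at hlarge
    have hl' : (4 * 4 ^ (#s + 1) * Fintype.card F : ℝ) < Fintype.card ι * Fintype.card V ^ 2 := by
      rw [hcard] at hlarge
      exact_mod_cast hlarge
    refine lt_of_pow_lt_pow_left₀ 2 (by positivity) ?_
    have h4 : ((2 : ℝ) ^ #s) ^ 2 = 4 ^ #s := by rw [← pow_mul, mul_comm, pow_mul]; norm_num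
    calc (4 * 2 ^ #s * B) ^ 2 = Fintype.card ι * (4 * 4 ^ (#s + 1) * Fintype.card F) := by
          rw [mul_pow, mul_pow, hBsq, h4]; ring
      _ < Fintype.card ι * (Fintype.card ι * Fintype.card V ^ 2) := by gcongr
      _ = T ^ 2 := by rw [hT]; ring
  have hprim : ∀ (d : ℕ) (ε : ℂ), d ∣ m → d = 2 ∨ d = 4 → ε = 1 ∨ ε = -1 →
      ∃ i, ∃ v ∈ V, (∀ l ∈ s, (b i + v) ^ (m / l) ≠ 1) ∧
        ∃ ψ : MulChar F ℂ, orderOf ψ = d ∧ ψ (b i + v) = ε := by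
    intro d ε hdm hd hε
    obtain ⟨ψ, hψ⟩ := exists_mulChar_complex_orderOf hdm
    have hε1 : ‖ε‖ = 1 := by rcases hε with rfl | rfl <;> simp
    have hεε : ε * ε = 1 := by rcases hε with rfl | rfl <;> norm_num
    have hεd : ε ^ d = 1 := by rcases hd with rfl | rfl <;> rcases hε with rfl | rfl <;> norm_num
    have hds : ∀ l ∈ s, ¬ l ∣ d := by
      intro l hl hld
      have : l ∣ 2 ^ 2 := hld.trans (by rcases hd with rfl | rfl <;> norm_num)
      exact hs2 l hl ((Nat.prime_dvd_prime_iff_eq (hsp l hl) Nat.prime_two).mp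
        ((hsp l hl).dvd_of_dvd_pow this))
    have hne := map_sum_mul_prod_nonKernelIndicator_ne_zero Λ (Real.sqrt_nonneg _) hT1 hΛB ω s hsp
      hω ψ (by omega) hψ hds ε hε1 (lt_of_le_of_lt (by
        have : (d : ℝ) ≤ 4 := by rcases hd with rfl | rfl <;> norm_num
        gcongr) hTB)
    rw [hΛ] at hne
    obtain ⟨i, -, hi⟩ := exists_ne_zero_of_sum_ne_zero hne
    obtain ⟨v, -, hv⟩ := exists_ne_zero_of_sum_ne_zero hi
    have hx0 := hb0 i v v.2
    rw [Pi.mul_apply, mul_ne_zero_iff, prod_apply, prod_ne_zero_iff] at hv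
    refine ⟨i, v, v.2, fun l hl hpow => hv.2 l hl ?_, ψ, hψ, ?_⟩
    · have h1 : ω l (b i + v) = 1 := by
        rw [MulChar.apply_eq_one_iff_pow_eq_one _ hx0, hω l hl]
        exact hpow
      have hl0 : (l : ℂ) ≠ 0 := by exact_mod_cast (hsp l hl).ne_zero
      simp [nonKernelIndicator, Finset.sum_apply, sum_pow_apply_eq_of_apply_eq_one hx0 h1, hl0]
    · by_contra hcon
      refine hv.1 ?_
      have hpow : ∀ j, (ψ ^ j) (b i + v) = ψ (b i + v) ^ j := fun j => by
        simpa using MulChar.pow_apply_coe ψ j (Units.mk0 _ hx0)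
      have hgeom := geom_sum_mul (ε * ψ (b i + v)) d
      rw [mul_pow, hεd, ← hpow, ← hψ, pow_orderOf_eq_one, MulChar.one_apply hx0.isUnit, one_mul,
        sub_self, hψ] at hgeom
      have hne1 : ε * ψ (b i + v) - 1 ≠ 0 := fun h => hcon (by
        linear_combination ε * h - (ψ (b i + v)) * hεε)
      simpa [Finset.sum_apply, hpow, mul_pow] using (mul_eq_zero.mp hgeom).resolve_right hne1
  have hprimes : ∀ l, l.Prime → l ∣ m / 2 → l ≠ 2 → l ∈ s := fun l hl hlm h2 => by
    simp [hs, h2, hl, hm0.ne', hlm.trans (Nat.div_dvd_of_dvd heven.two_dvd)]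
  have hhalf : 0 < m / 2 := Nat.div_pos (Nat.le_of_dvd hm0 heven.two_dvd) two_pos
  have hoddprime : ∀ (x : F) (l : ℕ), l ∣ m / 2 → x ^ (m / l) ≠ 1 → x ^ (m / 2 / l) ≠ 1 := by
    intro x l hl hx h
    refine hx ?_
    obtain ⟨c, hc⟩ := hl
    have hl0 : 0 < l := Nat.pos_of_ne_zero fun h => by simp [h] at hc; omega
    have : m = l * (c * 2) := by
      rw [← mul_assoc, ← hc, Nat.div_mul_cancel heven.two_dvd]
    rw [hc, Nat.mul_div_cancel_left _ hl0] at h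
    rw [this, Nat.mul_div_cancel_left _ hl0, pow_mul, h, one_pow]
  by_cases h4 : 4 ∣ m
  · obtain ⟨i, v, hvV, hl, ψ, hψ, hx⟩ := hprim 4 (-1) h4 (Or.inr rfl) (Or.inr rfl)
    have hx0 := hb0 i v hvV
    refine ⟨i, v, hvV, orderOf_eq_of_pow_and_pow_div_prime hhalf ?_ fun l hlp hlm => ?_⟩
    · have h1 : ψ ((b i + v) ^ 2) = 1 := by rw [map_pow, hx]; norm_num
      rw [MulChar.apply_eq_one_iff_pow_eq_one _ (pow_ne_zero 2 hx0), hψ, ← pow_mul] at h1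
      convert h1 using 2
      omega
    · by_cases h2 : l = 2
      · subst h2
        intro h
        have : ψ (b i + v) = 1 := by
          rw [MulChar.apply_eq_one_iff_pow_eq_one _ hx0, hψ, ← h, Nat.div_div_eq_div_mul]
        rw [this] at hx
        norm_num at hx
      · exact hoddprime _ l hlm (hl l (hprimes l hlp hlm h2))
  · obtain ⟨i, v, hvV, hl, ψ, hψ, hx⟩ := hprim 2 1 heven.two_dvd (Or.inl rfl) (Or.inl rfl)
    have hx0 := hb0 i v hvV
    refine ⟨i, v, hvV, orderOf_eq_of_pow_and_pow_div_prime hhalf ?_ fun l hlp hlm => ?_⟩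
    · rwa [MulChar.apply_eq_one_iff_pow_eq_one _ hx0, hψ] at hx
    · refine hoddprime _ l hlm (hl l (hprimes l hlp hlm ?_))
      rintro rfl
      have := heven.two_dvd
      omega

end PrimitiveSieve

section FrobeniusModule

open Polynomial

variable {K L : Type*} [Field K] [Field L] [Algebra K L] [Fintype K]

variable (K L) in
/-- The Frobenius `x ↦ x ^ #K` as a `K`-linear endomorphism of `L`. -/
noncomputable def frobeniusEnd : Module.End K L :=
  (FiniteField.frobeniusAlgHom K L).toLinearMap

theorem frobeniusEnd_pow_apply (i : ℕ) (x : L) :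
    (frobeniusEnd K L ^ i) x = x ^ Fintype.card K ^ i := by
  induction i with
  | zero => simp
  | succ i ih =>
    rw [pow_succ', Module.End.mul_apply, ih, pow_succ, pow_mul]
    rfl

variable [Fintype L]

theorem minpoly_frobeniusEnd :
    minpoly K (frobeniusEnd K L) = X ^ Module.finrank K L - 1 :=
  FiniteField.minpoly_frobeniusAlgHom K L

theorem frobeniusEnd_pow_finrank : frobeniusEnd K L ^ Module.finrank K L = 1 := by
  have h := minpoly.aeval K (frobeniusEnd K L)
  rw [minpoly_frobeniusEnd] at h
  simpa [sub_eq_zero] using h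

variable (K L) in
theorem exists_frobeniusEnd_cyclic :
    ∃ γ : L, ∀ x, ∃ P : K[X], aeval (frobeniusEnd K L) P γ = x := by
  refine ⟨IsGalois.normalBasis K L 1, fun x => ?_⟩
  have hx : x ∈ Submodule.span K (Set.range (IsGalois.normalBasis K L)) := by
    rw [Module.Basis.span_eq]
    trivial
  induction hx using Submodule.span_induction with
  | mem x hx =>
    obtain ⟨e, rfl⟩ := hx
    obtain ⟨i, hi⟩ := (FiniteField.bijective_frobeniusAlgEquivOfAlgebraic_pow K L).2 e
    refine ⟨X ^ (i : ℕ), ?_⟩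
    rw [IsGalois.normalBasis_apply e, ← hi, map_pow, aeval_X, frobeniusEnd_pow_apply,
      AlgEquiv.coe_pow, FiniteField.coe_frobeniusAlgEquivOfAlgebraic_iterate]
  | zero => exact ⟨0, by simp⟩
  | add x y _ _ hx hy =>
    obtain ⟨P, rfl⟩ := hx
    obtain ⟨R, rfl⟩ := hy
    exact ⟨P + R, by simp⟩
  | smul a x _ hx =>
    obtain ⟨P, rfl⟩ := hx
    exact ⟨a • P, by simp⟩

theorem dvd_of_aeval_cyclic_eq_zero {γ : L}
    (hγ : ∀ x, ∃ P : K[X], aeval (frobeniusEnd K L) P γ = x) {P : K[X]}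
    (hP : aeval (frobeniusEnd K L) P γ = 0) : X ^ Module.finrank K L - 1 ∣ P := by
  rw [← minpoly_frobeniusEnd]
  refine minpoly.dvd K _ (LinearMap.ext fun x => ?_)
  obtain ⟨R, rfl⟩ := hγ x
  rw [← Module.End.mul_apply, ← map_mul, mul_comm, map_mul, Module.End.mul_apply, hP, map_zero,
    LinearMap.zero_apply]

theorem aeval_frobeniusEnd_mem_conjSpan (α : L) (P : K[X]) :
    aeval (frobeniusEnd K L) P α ∈ conjSpan K (Fintype.card K) (Module.finrank K L) α := by
  rw [aeval_eq_sum_range, LinearMap.sum_apply]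
  refine Submodule.sum_mem _ fun i _ => Submodule.smul_mem _ _ (Submodule.subset_span ?_)
  refine ⟨⟨i % Module.finrank K L, Nat.mod_lt _ Module.finrank_pos⟩, ?_⟩
  simp only
  rw [← frobeniusEnd_pow_apply, ← pow_mod_orderOf,
    Nat.mod_mod_of_dvd _ (orderOf_dvd_of_pow_eq_one frobeniusEnd_pow_finrank), pow_mod_orderOf]

theorem finrank_le_of_forall_isRoot {W : Submodule K L} {g : L[X]} (hg : g ≠ 0) {k : ℕ}
    (hdeg : g.natDegree ≤ Fintype.card K ^ k) (hW : ∀ x ∈ W, g.eval x = 0) :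
    Module.finrank K W ≤ k := by
  classical
  have hcard : Fintype.card W ≤ Fintype.card K ^ k := by
    calc Fintype.card W = #((univ : Finset W).map ⟨Subtype.val, Subtype.val_injective⟩) := by simp
      _ ≤ #g.roots.toFinset := by
          refine card_le_card fun x hx => ?_
          simp only [mem_map, mem_univ, true_and, Function.Embedding.coeFn_mk] at hx
          obtain ⟨w, rfl⟩ := hx
          rw [Multiset.mem_toFinset, mem_roots hg]
          exact hW w w.2
      _ ≤ g.roots.card := Multiset.toFinset_card_le _
      _ ≤ g.natDegree := card_roots' g
      _ ≤ _ := hdeg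
  rw [Module.card_eq_pow_finrank (K := K) (V := W)] at hcard
  exact (Nat.pow_le_pow_iff_right Fintype.one_lt_card).mp hcard

theorem finrank_range_frobeniusEnd_sub_one :
    Module.finrank K (LinearMap.range (aeval (frobeniusEnd K L) (X - 1 : K[X]))) =
      Module.finrank K L - 1 := by
  set f := aeval (frobeniusEnd K L) (X - 1 : K[X]) with hf
  have hq : 1 < Fintype.card K := Fintype.one_lt_card
  have hle : Module.finrank K (LinearMap.ker f) ≤ 1 := by
    refine finrank_le_of_forall_isRoot (FiniteField.X_pow_card_sub_X_ne_zero L hq) ?_ fun x hx => ?_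
    · rw [FiniteField.X_pow_card_sub_X_natDegree_eq L hq, pow_one]
    · rw [LinearMap.mem_ker] at hx
      have h1 := frobeniusEnd_pow_apply (K := K) 1 x
      rw [pow_one, pow_one] at h1
      simpa [hf, h1] using hx
  have hge : Module.finrank K (LinearMap.ker f) ≠ 0 := by
    rw [Submodule.finrank_eq_zero.ne, Submodule.ne_bot_iff]
    refine ⟨1, ?_, one_ne_zero⟩
    have h1 := frobeniusEnd_pow_apply (K := K) (L := L) 1 1
    rw [pow_one, one_pow] at h1
    simp [hf, h1]
  have := LinearMap.finrank_range_add_finrank_ker f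
  omega

theorem le_finrank_range_frobeniusEnd (u : ℕ) (hu : 0 < u) :
    Module.finrank K L - (u + 1) ≤ Module.finrank K
      (LinearMap.range (aeval (frobeniusEnd K L) ((X - 1) * (X ^ u - 1) : K[X]))) := by
  set f := aeval (frobeniusEnd K L) ((X - 1) * (X ^ u - 1) : K[X]) with hf
  set q := Fintype.card K with hqdef
  have hq : 1 < q := Fintype.one_lt_card
  have hdeg : (X ^ q ^ u + X ^ q - X : L[X]).degree < (q ^ (u + 1) : ℕ) := by
    refine (degree_sub_le _ _).trans_lt (max_lt ((degree_add_le _ _).trans_lt (max_lt ?_ ?_)) ?_)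
    · rw [degree_X_pow]
      exact_mod_cast Nat.pow_lt_pow_right hq u.lt_succ_self
    · rw [degree_X_pow]
      exact_mod_cast lt_self_pow₀ hq (by omega)
    · rw [degree_X]
      exact_mod_cast Nat.one_lt_pow (by omega) hq
  have hle : Module.finrank K (LinearMap.ker f) ≤ u + 1 := by
    refine finrank_le_of_forall_isRoot (g := X ^ q ^ (u + 1) - (X ^ q ^ u + X ^ q - X))
      (monic_X_pow_sub hdeg).ne_zero ?_ fun x hx => ?_
    · exact natDegree_le_of_degree_le
        ((degree_sub_le _ _).trans (max_le (degree_X_pow_le _) hdeg.le))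
    · rw [LinearMap.mem_ker, hf, show ((X - 1) * (X ^ u - 1) : K[X]) =
        X ^ (u + 1) - (X ^ u + X ^ 1 - X ^ 0) by ring] at hx
      simp only [map_sub, map_add, map_pow, aeval_X, LinearMap.sub_apply, LinearMap.add_apply,
        frobeniusEnd_pow_apply] at hx
      simpa using hx
  have := LinearMap.finrank_range_add_finrank_ker f
  omega

theorem conjSpan_eq_range_of_isCoprime {γ : L}
    (hγ : ∀ x, ∃ P : K[X], aeval (frobeniusEnd K L) P γ = x) {r : K[X]}
    (hr : IsCoprime r (X ^ Module.finrank K L - 1)) :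
    conjSpan K (Fintype.card K) (Module.finrank K L)
        (aeval (frobeniusEnd K L) ((X - 1) * r) γ) =
      LinearMap.range (aeval (frobeniusEnd K L) (X - 1 : K[X])) := by
  have hmul : ∀ (P R : K[X]) (x : L), aeval (frobeniusEnd K L) (P * R) x =
      aeval (frobeniusEnd K L) P (aeval (frobeniusEnd K L) R x) := fun P R x => by
    rw [map_mul, Module.End.mul_apply]
  refine le_antisymm (Submodule.span_le.mpr ?_) ?_
  · rintro _ ⟨i, rfl⟩
    refine ⟨aeval (frobeniusEnd K L) (X ^ (i : ℕ) * r) γ, ?_⟩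
    simp only
    rw [← frobeniusEnd_pow_apply, ← hmul, ← aeval_X (R := K) (frobeniusEnd K L), ← map_pow, aeval_X,
      ← hmul]
    congr 2
    ring
  · rintro _ ⟨x, rfl⟩
    obtain ⟨P, rfl⟩ := hγ x
    obtain ⟨a, c, hac⟩ := hr
    have hzero : aeval (frobeniusEnd K L) (X ^ Module.finrank K L - 1 : K[X]) = 0 := by
      rw [← minpoly_frobeniusEnd]
      exact minpoly.aeval K _
    have hγ' : aeval (frobeniusEnd K L) (a * r) γ = γ := by
      rw [eq_sub_of_add_eq hac, map_sub, map_mul, hzero]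
      simp
    have : aeval (frobeniusEnd K L) (X - 1 : K[X]) (aeval (frobeniusEnd K L) P γ) =
        aeval (frobeniusEnd K L) (P * a) (aeval (frobeniusEnd K L) ((X - 1) * r) γ) := by
      conv_lhs => rw [← hγ', ← hmul, ← hmul]
      rw [← hmul]
      congr 2
      ring
    rw [this]
    exact aeval_frobeniusEnd_mem_conjSpan _ _

end FrobeniusModule

section Numerics

theorem sixteen_pow_card_primeFactors_le {m : ℕ} (hm : m ≠ 0) :
    16 ^ #m.primeFactors * 30030 ≤ 16 ^ 6 * m := by
  set s := m.primeFactors with hs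
  set A : Finset ℕ := {2, 3, 5, 7, 11, 13} with hA
  have hA16 : ∀ l ∈ A, l ≤ 16 := by decide
  have hAp : ∀ l < 16, l.Prime → l ∈ A := by decide
  have hsA : ∀ l ∈ s \ A, 16 ≤ l := fun l hl => by
    by_contra h
    exact (mem_sdiff.mp hl).2 (hAp l (not_le.mp h)
      (Nat.prime_of_mem_primeFactors (mem_sdiff.mp hl).1))
  have hprod : ∏ l ∈ s, l ≤ m := Nat.le_of_dvd (Nat.pos_of_ne_zero hm) (Nat.prod_primeFactors_dvd m)
  calc 16 ^ #s * 30030 = (∏ _l ∈ s, 16) * ∏ l ∈ A, l := by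
        rw [prod_const]; rfl
    _ = ((∏ _l ∈ s ∩ A, 16) * (∏ _l ∈ s \ A, 16)) * ((∏ l ∈ A ∩ s, l) * ∏ l ∈ A \ s, l) := by
        rw [prod_inter_mul_prod_sdiff, prod_inter_mul_prod_sdiff]
    _ ≤ ((∏ _l ∈ s ∩ A, 16) * (∏ l ∈ s \ A, l)) * ((∏ l ∈ A ∩ s, l) * ∏ _l ∈ A \ s, 16) := by
        gcongr with l hl l hl
        · exact hsA l hl
        · exact hA16 l (mem_sdiff.mp hl).1
    _ = ((∏ _l ∈ A ∩ s, 16) * (∏ _l ∈ A \ s, 16)) * ((∏ l ∈ s ∩ A, l) * ∏ l ∈ s \ A, l) := by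
        rw [inter_comm s A]; ring
    _ = 16 ^ 6 * ∏ l ∈ s, l := by
        rw [prod_inter_mul_prod_sdiff, prod_inter_mul_prod_sdiff, prod_const]; rfl
    _ ≤ _ := by gcongr

theorem card_primeFactors_le_of_dvd_prod_pow {m k : ℕ} {A : Finset ℕ} (hA : ∀ l ∈ A, l.Prime)
    (hm : m ∣ (∏ l ∈ A, l) ^ k) : #m.primeFactors ≤ #A := by
  refine card_le_card fun l hl => ?_
  have hlp := Nat.prime_of_mem_primeFactors hl
  obtain ⟨r, hr, hlr⟩ := (hlp.prime.dvd_finsetProd_iff _).mp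
    (hlp.dvd_of_dvd_pow ((Nat.dvd_of_mem_primeFactors hl).trans hm))
  exact ((Nat.prime_dvd_prime_iff_eq hlp (hA r hr)).mp hlr) ▸ hr

theorem card_primeFactors_five_pow_fifteen_sub_one_le : #(5 ^ 15 - 1).primeFactors ≤ 6 :=
  card_primeFactors_le_of_dvd_prod_pow (A := {2, 11, 31, 71, 181, 1741}) (k := 2)
    (by simp only [mem_insert, mem_singleton, forall_eq_or_imp, forall_eq]; norm_num)
    (by rw [show ∏ l ∈ ({2, 11, 31, 71, 181, 1741} : Finset ℕ), l = 15258789062 from rfl]; norm_num)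

theorem card_primeFactors_five_pow_twenty_sub_one_le : #(5 ^ 20 - 1).primeFactors ≤ 8 :=
  card_primeFactors_le_of_dvd_prod_pow (A := {2, 3, 11, 13, 41, 71, 521, 9161}) (k := 4)
    (by simp only [mem_insert, mem_singleton, forall_eq_or_imp, forall_eq]; norm_num)
    (by
      rw [show ∏ l ∈ ({2, 3, 11, 13, 41, 71, 521, 9161} : Finset ℕ), l = 11920928955078 from rfl]
      norm_num)

theorem four_mul_four_pow_card_primeFactors_lt_of_le {q n u : ℕ} (hq : 2 ≤ q) (hun : u + 1 ≤ n)
    (h : 8944 * q ^ (4 * u + 4) ≤ (q - 1) ^ 4 * q ^ n) :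
    4 * 4 ^ #(q ^ n - 1).primeFactors * q ^ n < (q - 1) ^ 2 * (q ^ (n - (u + 1))) ^ 2 := by
  have hqn : 1 < q ^ n := Nat.one_lt_pow (by omega) (by omega)
  have hω := sixteen_pow_card_primeFactors_le (m := q ^ n - 1) (by omega)
  set w := #(q ^ n - 1).primeFactors
  have hω' : 16 ^ w < 559 * q ^ n := by omega
  refine lt_of_pow_lt_pow_left₀ 2 (by positivity) ?_
  have hpos : 0 < q ^ (4 * u + 4) := by positivity
  refine Nat.lt_of_mul_lt_mul_right (a := q ^ (4 * u + 4)) ?_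
  have h16 : (4 ^ w) ^ 2 = 16 ^ w := by rw [← pow_mul, mul_comm, pow_mul]; norm_num
  calc (4 * 4 ^ w * q ^ n) ^ 2 * q ^ (4 * u + 4)
      = 16 * 16 ^ w * (q ^ n) ^ 2 * q ^ (4 * u + 4) := by
        rw [mul_pow, mul_pow, h16]; ring
    _ < 16 * (559 * q ^ n) * (q ^ n) ^ 2 * q ^ (4 * u + 4) := by gcongr
    _ = (q ^ n) ^ 3 * (8944 * q ^ (4 * u + 4)) := by ring
    _ ≤ (q ^ n) ^ 3 * ((q - 1) ^ 4 * q ^ n) := by gcongr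
    _ = (q - 1) ^ 4 * (q ^ (n - (u + 1)) * q ^ (u + 1)) ^ 4 := by
        rw [← pow_add, Nat.sub_add_cancel hun]; ring
    _ = _ := by
        rw [mul_pow, ← pow_mul q (u + 1) 4]; ring

theorem mul_pow_le_pred_pow_mul_pow {q k a : ℕ} (ha : 2 ≤ a) (haq : a ≤ q)
    (h : 8944 * a ^ 4 ≤ (a - 1) ^ 4 * a ^ k) (u n : ℕ) (hn : 4 * u + k ≤ n) :
    8944 * q ^ (4 * u + 4) ≤ (q - 1) ^ 4 * q ^ n := by
  have hratio : q * (a - 1) ≤ a * (q - 1) := by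
    obtain ⟨b, rfl⟩ : ∃ b, a = b + 1 := ⟨a - 1, by omega⟩
    obtain ⟨c, rfl⟩ : ∃ c, q = c + 1 := ⟨q - 1, by omega⟩
    simp only [Nat.add_sub_cancel]
    nlinarith
  refine le_of_mul_le_mul_left (a := a ^ 4) ?_ (by positivity)
  calc a ^ 4 * (8944 * q ^ (4 * u + 4)) = 8944 * a ^ 4 * q ^ (4 * u + 4) := by ring
    _ ≤ (a - 1) ^ 4 * a ^ k * q ^ (4 * u + 4) := by gcongr
    _ ≤ (a - 1) ^ 4 * q ^ k * q ^ (4 * u + 4) := by gcongr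
    _ = (q * (a - 1)) ^ 4 * q ^ (4 * u + k) := by ring
    _ ≤ (a * (q - 1)) ^ 4 * q ^ n := by
        gcongr
        omega
    _ = _ := by ring

theorem four_mul_four_pow_card_primeFactors_lt {p t u : ℕ} (hp : p.Prime) (hp3 : 3 < p)
    (ht : 1 ≤ t) (hgcd : Nat.gcd p u = 1) (hu : 2 < u) :
    4 * 4 ^ #((p ^ t) ^ (p * u) - 1).primeFactors * (p ^ t) ^ (p * u) <
      (p ^ t - 1) ^ 2 * ((p ^ t) ^ (p * u - (u + 1))) ^ 2 := by
  have hpq : p ≤ p ^ t := Nat.le_self_pow (by omega) p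
  have hp5 : 5 ≤ p := by
    by_contra h
    have : p = 4 := by omega
    subst this
    norm_num at hp
  have hun : u + 1 ≤ p * u := by nlinarith
  by_cases h7 : 7 ≤ p
  · exact four_mul_four_pow_card_primeFactors_lt_of_le (by omega) hun
      (mul_pow_le_pred_pow_mul_pow (a := 7) (k := 9) (by norm_num) (h7.trans hpq) (by norm_num) _ _
        (by nlinarith))
  obtain rfl : p = 5 := by
    by_contra h
    have : p = 6 := by omega
    subst this
    norm_num at hp
  by_cases ht2 : 2 ≤ t
  · have : 5 ^ 2 ≤ 5 ^ t := Nat.pow_le_pow_right (by norm_num) ht2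
    exact four_mul_four_pow_card_primeFactors_lt_of_le (by omega) hun
      (mul_pow_le_pred_pow_mul_pow (a := 25) (k := 3) (by norm_num) this (by norm_num) _ _
        (by omega))
  obtain rfl : t = 1 := by omega
  by_cases hu7 : 7 ≤ u
  · exact four_mul_four_pow_card_primeFactors_lt_of_le (by omega) hun
      (mul_pow_le_pred_pow_mul_pow (a := 5) (k := 7) (by norm_num) hpq (by norm_num) _ _
        (by omega))
  rw [pow_one]
  have key : ∀ {w k : ℕ}, w ≤ k →
      4 * 4 ^ k * 5 ^ (5 * u) < (5 - 1) ^ 2 * (5 ^ (5 * u - (u + 1))) ^ 2 →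
      4 * 4 ^ w * 5 ^ (5 * u) < (5 - 1) ^ 2 * (5 ^ (5 * u - (u + 1))) ^ 2 := fun hwk h =>
    lt_of_le_of_lt (by gcongr; norm_num) h
  interval_cases u
  · exact key card_primeFactors_five_pow_fifteen_sub_one_le (by norm_num)
  · exact key card_primeFactors_five_pow_twenty_sub_one_le (by norm_num)
  · norm_num at hgcd
  · refine key (k := 19) ?_ (by norm_num)
    have hω := sixteen_pow_card_primeFactors_le (m := 5 ^ (5 * 6) - 1) (by norm_num)
    generalize #(5 ^ (5 * 6) - 1).primeFactors = w at hω
    by_contra h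
    have : 16 ^ 20 ≤ 16 ^ w := Nat.pow_le_pow_right (by norm_num) (by omega)
    norm_num at hω this
    omega

end Numerics

section OneNormalCosets

open Polynomial

theorem isCoprime_X_sub_one_of_eval_ne_zero {K : Type*} [Field K] {r : K[X]} (h : r.eval 1 ≠ 0) :
    IsCoprime r (X - 1) := by
  rw [← C_1]
  refine (((irreducible_X_sub_C (1 : K)).coprime_iff_not_dvd).mpr fun hd => h ?_).symm
  exact dvd_iff_isRoot.mp hd

/-- Modulo `X ^ u - 1`, the polynomial taking the value `e` at `1` and congruent to `c` modulo
`1 + X + ⋯ + X ^ (u - 1)`. -/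
noncomputable def geomInterpolant {K : Type*} [Field K] (u : ℕ) (c e : K) : K[X] :=
  C c + C ((e - c) / u) * ∑ j ∈ range u, X ^ j

variable {K L : Type*} [Field K]

theorem eval_one_geomInterpolant {u : ℕ} (hu : (u : K) ≠ 0) (c e : K) :
    (geomInterpolant u c e).eval 1 = e := by
  simp [geomInterpolant, eval_finsetSum, div_mul_cancel₀ _ hu]

theorem isCoprime_geomInterpolant_add {u : ℕ} (hu : (u : K) ≠ 0) {c e : K} (hc : c ≠ 0)
    (he : e ≠ 0) (s : K[X]) :
    IsCoprime (geomInterpolant u c e + (X ^ u - 1) * s) (X ^ u - 1) := by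
  have hfac : (X ^ u - 1 : K[X]) = (∑ j ∈ range u, X ^ j) * (X - 1) := (geom_sum_mul X u).symm
  have hcop : IsCoprime (geomInterpolant u c e) (X ^ u - 1) := by
    rw [hfac]
    refine IsCoprime.mul_right ?_ (isCoprime_X_sub_one_of_eval_ne_zero ?_)
    · exact IsCoprime.add_mul_right_left ⟨C c⁻¹, 0, by simp [← C_mul, hc]⟩ _
    · rwa [eval_one_geomInterpolant hu]
  exact hcop.add_mul_left_left s

theorem geomInterpolant_eq_of_dvd {u : ℕ} (hu2 : 2 ≤ u) (hu : (u : K) ≠ 0) {c e c' e' : K}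
    (h : (X ^ u - 1 : K[X]) ∣ geomInterpolant u c e - geomInterpolant u c' e') :
    c = c' ∧ e = e' := by
  have hfac : (X ^ u - 1 : K[X]) = (∑ j ∈ range u, X ^ j) * (X - 1) := (geom_sum_mul X u).symm
  constructor
  · have h1 : (∑ j ∈ range u, X ^ j : K[X]) ∣ C (c - c') := by
      have h2 := (Dvd.intro _ hfac.symm).trans h
      have h3 : geomInterpolant u c e - geomInterpolant u c' e' = C (c - c') +
          (∑ j ∈ range u, X ^ j) * (C ((e - c) / u) - C ((e' - c') / u)) := by
        rw [geomInterpolant, geomInterpolant, C_sub]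
        ring
      rw [h3] at h2
      exact (dvd_add_left (dvd_mul_right _ _)).mp h2
    by_contra hne
    have h4 := isUnit_of_dvd_unit h1 (isUnit_C.mpr (sub_ne_zero.mpr hne).isUnit)
    have h5 : (∑ j ∈ range u, X ^ j : K[X]).natDegree = u - 1 := by
      have h6 : (X ^ u - C 1 : K[X]).natDegree = u := natDegree_X_pow_sub_C
      have hX : (X - 1 : K[X]) = X - C 1 := by rw [C_1]
      rw [C_1, hfac, hX, natDegree_mul h4.ne_zero (X_sub_C_ne_zero 1),
        natDegree_X_sub_C] at h6
      omega
    have := natDegree_eq_zero_of_isUnit h4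
    omega
  · have h1 := (Dvd.intro_left _ hfac.symm).trans h
    rw [← C_1, dvd_iff_isRoot, IsRoot, eval_sub, eval_one_geomInterpolant hu,
      eval_one_geomInterpolant hu] at h1
    exact sub_eq_zero.mp h1

variable [Field L] [Algebra K L] [Fintype K] [Fintype L]

theorem exists_orderOf_eq_half_and_finrank_conjSpan_eq {p u : ℕ} [Fact p.Prime] [CharP K p]
    (hp2 : 2 ≤ p) (hu2 : 2 ≤ u) (hu : (u : K) ≠ 0) (hn : Module.finrank K L = p * u)
    (heven : Even (Fintype.card L - 1))
    (hlarge : 4 * 4 ^ #(Fintype.card L - 1).primeFactors * Fintype.card L <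
      (Fintype.card K - 1) ^ 2 * (Fintype.card K ^ (p * u - (u + 1))) ^ 2) :
    ∃ α : L, orderOf α = (Fintype.card L - 1) / 2 ∧
      Module.finrank K (conjSpan K (Fintype.card K) (p * u) α) = p * u - 1 := by
  classical
  obtain ⟨γ, hγ⟩ := exists_frobeniusEnd_cyclic K L
  set A := aeval (R := K) (frobeniusEnd K L) with hA
  have hpow : (X ^ Module.finrank K L - 1 : K[X]) = (X ^ u - 1) ^ p := by
    rw [sub_pow_char, one_pow, ← pow_mul, hn, mul_comm]
  let b : Kˣ × Kˣ → L := fun z => A ((X - 1) * geomInterpolant u (z.1 : K) (z.2 : K)) γ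
  let V : AddSubgroup L := (LinearMap.range (A ((X - 1) * (X ^ u - 1)))).toAddSubgroup
  have hV : ∀ v ∈ V, ∃ s : K[X], v = A ((X - 1) * ((X ^ u - 1) * s)) γ := by
    rintro _ ⟨y, rfl⟩
    obtain ⟨s, rfl⟩ := hγ y
    refine ⟨s, ?_⟩
    rw [← mul_assoc, map_mul A _ s, Module.End.mul_apply]
  have hnormal : ∀ z, ∀ v ∈ V,
      Module.finrank K (conjSpan K (Fintype.card K) (p * u) (b z + v)) = p * u - 1 := by
    intro z v hv
    obtain ⟨s, rfl⟩ := hV v hv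
    have hcop : IsCoprime (geomInterpolant u (z.1 : K) (z.2 : K) + (X ^ u - 1) * s)
        (X ^ Module.finrank K L - 1) := by
      rw [hpow]
      exact (isCoprime_geomInterpolant_add hu z.1.ne_zero z.2.ne_zero s).pow_right
    have h := conjSpan_eq_range_of_isCoprime hγ hcop
    rw [mul_add, map_add, LinearMap.add_apply, hn] at h
    rw [h, finrank_range_frobeniusEnd_sub_one, hn]
  have hn2 : 2 ≤ p * u := by nlinarith
  have hne : ∀ z, ∀ v ∈ V, b z + v ≠ 0 := by
    intro z v hv h0
    have h := hnormal z v hv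
    have hbot : conjSpan K (Fintype.card K) (p * u) (0 : L) = ⊥ := by
      rw [conjSpan, Submodule.span_eq_bot]
      rintro _ ⟨i, rfl⟩
      exact zero_pow (pow_ne_zero _ Fintype.card_ne_zero)
    rw [h0, hbot, finrank_bot] at h
    omega
  have hinj : ∀ z z', b z - b z' ∈ V → z = z' := by
    intro z z' hz
    obtain ⟨s, hs⟩ := hV _ hz
    have h0 : A ((X - 1) * (geomInterpolant u (z.1 : K) (z.2 : K) -
        geomInterpolant u (z'.1 : K) (z'.2 : K) - (X ^ u - 1) * s)) γ = 0 := by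
      rw [mul_sub, mul_sub, map_sub, map_sub, LinearMap.sub_apply, LinearMap.sub_apply, ← hs,
        sub_self]
    have hdvd := dvd_of_aeval_cyclic_eq_zero hγ h0
    rw [hpow] at hdvd
    have hX1 : (X - 1 : K[X]) ≠ 0 := X_sub_C_ne_zero 1
    have hsq : (X - 1) * (X ^ u - 1) ∣ (X ^ u - 1 : K[X]) ^ 2 := by
      rw [sq]
      exact mul_dvd_mul_right (sub_one_dvd_pow_sub_one _ _) _
    have hdvd' := (mul_dvd_mul_iff_left hX1).mp (hsq.trans ((pow_dvd_pow _ hp2).trans hdvd))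
    have := geomInterpolant_eq_of_dvd hu2 hu
      ((dvd_sub_left (dvd_mul_right _ _)).mp hdvd')
    exact Prod.ext (Units.ext this.1) (Units.ext this.2)
  have hcardV : Fintype.card K ^ (p * u - (u + 1)) ≤ Fintype.card V := by
    have h1 := le_finrank_range_frobeniusEnd (K := K) (L := L) u (by omega)
    rw [hn] at h1
    have h2 := Module.card_eq_pow_finrank (K := K)
      (V := LinearMap.range (A ((X - 1) * (X ^ u - 1))))
    calc _ ≤ _ := Nat.pow_le_pow_right Fintype.card_pos h1
      _ = _ := h2.symm
      _ = Fintype.card V := Fintype.card_congr (Equiv.refl _)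
  obtain ⟨z, v, hv, hord⟩ := exists_orderOf_eq_half_of_cosets heven b V hinj hne (by
    rw [Fintype.card_prod, Fintype.card_units, ← sq]
    exact hlarge.trans_le (by gcongr))
  exact ⟨b z + v, hord, hnormal z v hv⟩

end OneNormalCosets

/-- Let `p > 3` be prime, `q = p^t`, and `n = p u` with `gcd(p, u) = 1` and `u > 2`. Then there
exists an element of `F_{q^n}` that is simultaneously `2`-primitive and `1`-normal over `F_q`. -/
theorem stmt_8 (p t q n u : ℕ) (hp : p.Prime) (hp3 : 3 < p) (ht : 1 ≤ t) (hq : q = p ^ t)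
    (hgcd : Nat.gcd p u = 1) (hu : 2 < u) (hn : n = p * u)
    (K L : Type*) [Field K] [Field L] [Algebra K L] [Fintype K] [Fintype L]
    (hK : Fintype.card K = q) (hL : Fintype.card L = q ^ n) :
    ∃ α : L, orderOf α = (q ^ n - 1) / 2 ∧
      Module.finrank K (conjSpan K q n α) = n - 1 := by
  have : Fact p.Prime := ⟨hp⟩
  have : CharP K p := charP_of_card_eq_prime_pow (hK.trans hq)
  have huK : (u : K) ≠ 0 := by
    rw [Ne, CharP.cast_eq_zero_iff K p]
    exact (hp.coprime_iff_not_dvd).mp hgcd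
  have hfin : Module.finrank K L = p * u := by
    have h := Module.card_eq_pow_finrank (K := K) (V := L)
    rw [hL, ← hK, ← hn] at *
    exact (Nat.pow_right_injective Fintype.one_lt_card h).symm
  have hodd : Odd p := hp.odd_of_ne_two (by omega)
  have hnum := four_mul_four_pow_card_primeFactors_lt hp hp3 ht hgcd hu
  subst hn
  rw [← hL, ← hK]
  refine exists_orderOf_eq_half_and_finrank_conjSpan_eq (by omega) hu.le huK hfin ?_ ?_
  · rw [hL, hq]
    exact Nat.Odd.sub_odd hodd.pow.pow odd_one
  · rw [hL, hK, hq]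
    exact hnum
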